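/- arXiv:2310.10600 — 2 statements merged into one kernel-verified Lean document; each statement's English description precedes it below -/
import Mathlib

section
/- (Pseudotelepathy implies full nonlocality.) Let (π, W) be a nonlocal game with classical value ω_C(π,W) < 1, and let p be a no-signaling correlation with winning probability ω^p(π,W) = 1. Then for every q ∈ [0,1], every local correlation p_L, and every no-signaling correlation p_NL such that p(a,b|x,y) = q·p_L(a,b|x,y) + (1−q)·p_NL(a,b|x,y) for all a,b,x,y, one has q = 0. Consequently q_L^max(p) = 0. -/
open Finset

variable {A B X Y : Type*} [Fintype A] [Fintype B] [Fintype X] [Fintype Y]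
  [DecidableEq A] [DecidableEq B] [DecidableEq X] [DecidableEq Y]

/-- A (bipartite) correlation: nonnegative entries, normalized for each pair of settings. -/
def IsCorrelation (p : A → B → X → Y → ℝ) : Prop :=
  (∀ a b x y, 0 ≤ p a b x y) ∧ (∀ x y, ∑ a, ∑ b, p a b x y = 1)

/-- The no-signaling conditions: Alice's marginal does not depend on Bob's setting and
vice versa. -/
def NoSignaling (p : A → B → X → Y → ℝ) : Prop :=
  (∀ a x y y', ∑ b, p a b x y = ∑ b, p a b x y') ∧
  (∀ b y x x', ∑ a, p a b x y = ∑ a, p a b x' y)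

/-- A no-signaling correlation. -/
def IsNSCorrelation (p : A → B → X → Y → ℝ) : Prop :=
  IsCorrelation p ∧ NoSignaling p

/-- The deterministic local correlation associated to outcome assignments `f`, `g`. -/
def detLocal (f : X → A) (g : Y → B) : A → B → X → Y → ℝ :=
  fun a b x y => (if a = f x then (1:ℝ) else 0) * (if b = g y then (1:ℝ) else 0)

/-- A local correlation: a convex combination of deterministic local correlations. -/
def IsLocal (p : A → B → X → Y → ℝ) : Prop :=
  ∃ μ : (X → A) × (Y → B) → ℝ, (∀ fg, 0 ≤ μ fg) ∧ (∑ fg, μ fg = 1) ∧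
    ∀ a b x y, p a b x y = ∑ fg, μ fg * detLocal fg.1 fg.2 a b x y

/-- The local content `q_L^max` of a correlation: the supremum of the local weight over
all decompositions into a local part and a no-signaling part. -/
noncomputable def localContent (p : A → B → X → Y → ℝ) : ℝ :=
  sSup {q : ℝ | 0 ≤ q ∧ q ≤ 1 ∧ ∃ pL pNL : A → B → X → Y → ℝ,
    IsLocal pL ∧ IsNSCorrelation pNL ∧
    ∀ a b x y, p a b x y = q * pL a b x y + (1 - q) * pNL a b x y}

/-- The winning probability of a correlation `p` in the nonlocal game `(π, W)`. -/
def winProb (p : A → B → X → Y → ℝ) (pi : X → Y → ℝ) (W : A → B → X → Y → Bool) : ℝ :=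
  ∑ a, ∑ b, ∑ x, ∑ y, pi x y * (if W a b x y then (1:ℝ) else 0) * p a b x y

/-- The classical value of a nonlocal game: the maximum winning probability over
deterministic local strategies. -/
noncomputable def classicalValue (pi : X → Y → ℝ) (W : A → B → X → Y → Bool) : ℝ :=
  ⨆ fg : (X → A) × (Y → B), winProb (detLocal fg.1 fg.2) pi W

/-- The set of no-signaling correlations. -/
def NSSet (A B X Y : Type*) [Fintype A] [Fintype B] [Fintype X] [Fintype Y] :
    Set (A → B → X → Y → ℝ) := {p | IsNSCorrelation p}

/-- A face of the no-signaling set: a subset of `NS` that is extreme in `NS`. -/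
def IsFace (F : Set (A → B → X → Y → ℝ)) : Prop :=
  F ⊆ NSSet A B X Y ∧ ∀ p ∈ F, ∀ p₁ ∈ NSSet A B X Y, ∀ p₂ ∈ NSSet A B X Y,
    ∀ t : ℝ, 0 < t → t < 1 →
    (∀ a b x y, p a b x y = t * p₁ a b x y + (1 - t) * p₂ a b x y) →
    p₁ ∈ F ∧ p₂ ∈ F

/-- A correlation `p` realizes a table of zeros `Z` if it vanishes on every entry of `Z`. -/
def Realizes (p : A → B → X → Y → ℝ) (Z : Set (A × B × X × Y)) : Prop :=
  ∀ a b x y, (a, b, x, y) ∈ Z → p a b x y = 0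

/-- A table of zeros is LHV-realizable if some deterministic outcome assignment avoids
all its zeros. -/
def LHVRealizable (Z : Set (A × B × X × Y)) : Prop :=
  ∃ (f : X → A) (g : Y → B), ∀ x y, (f x, g y, x, y) ∉ Z

/-- The winning probability, summed over settings first. -/
theorem winProb_eq_sum_settings {A B X Y : Type*} [Fintype A] [Fintype B] [Fintype X] [Fintype Y]
    (p : A → B → X → Y → ℝ) (pi : X → Y → ℝ) (W : A → B → X → Y → Bool) :
    winProb p pi W =
      ∑ x, ∑ y, ∑ a, ∑ b, pi x y * (if W a b x y then (1:ℝ) else 0) * p a b x y := by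
  unfold winProb
  simp_rw [← Fintype.sum_prod_type']
  rw [← Equiv.sum_comp ((Equiv.prodAssoc A B (X × Y)).symm.trans
    ((Equiv.prodComm (A × B) (X × Y)).trans (Equiv.prodAssoc X Y (A × B))))]
  rfl

/-- A correlation wins with probability at most one. -/
theorem winProb_le_one {A B X Y : Type*} [Fintype A] [Fintype B] [Fintype X] [Fintype Y]
    {p : A → B → X → Y → ℝ} (hp : IsCorrelation p) {pi : X → Y → ℝ}
    (hpi : ∀ x y, 0 ≤ pi x y) (hsum : ∑ x, ∑ y, pi x y = 1) (W : A → B → X → Y → Bool) :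
    winProb p pi W ≤ 1 := by
  rw [winProb_eq_sum_settings]
  refine le_of_le_of_eq ?_ hsum
  refine sum_le_sum fun x _ => sum_le_sum fun y _ => ?_
  calc ∑ a, ∑ b, pi x y * (if W a b x y then (1:ℝ) else 0) * p a b x y
      ≤ ∑ a, ∑ b, pi x y * p a b x y := by
        refine sum_le_sum fun a _ => sum_le_sum fun b _ => ?_
        have h := mul_nonneg (hpi x y) (hp.1 a b x y)
        split_ifs <;> simp [h]
    _ = pi x y := by
        simp_rw [← mul_sum]
        rw [hp.2 x y, mul_one]

/-- The winning probability of a mixture is the mixture of the winning probabilities. -/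
theorem winProb_mixture {A B X Y : Type*} [Fintype A] [Fintype B] [Fintype X] [Fintype Y]
    {p p₁ p₂ : A → B → X → Y → ℝ} {s t : ℝ}
    (h : ∀ a b x y, p a b x y = s * p₁ a b x y + t * p₂ a b x y)
    (pi : X → Y → ℝ) (W : A → B → X → Y → Bool) :
    winProb p pi W = s * winProb p₁ pi W + t * winProb p₂ pi W := by
  simp only [winProb, h, mul_sum, ← sum_add_distrib]
  refine sum_congr rfl fun a _ => sum_congr rfl fun b _ => sum_congr rfl fun x _ =>
    sum_congr rfl fun y _ => ?_
  ring

/-- The winning probability commutes with finite linear combinations. -/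
theorem winProb_sum {A B X Y ι : Type*} [Fintype A] [Fintype B] [Fintype X] [Fintype Y]
    [Fintype ι] {p : A → B → X → Y → ℝ} {μ : ι → ℝ} {d : ι → A → B → X → Y → ℝ}
    (h : ∀ a b x y, p a b x y = ∑ i, μ i * d i a b x y)
    (pi : X → Y → ℝ) (W : A → B → X → Y → Bool) :
    winProb p pi W = ∑ i, μ i * winProb (d i) pi W := by
  simp only [winProb, h, mul_sum]
  simp_rw [sum_comm (s := (univ : Finset ι))]
  refine sum_congr rfl fun a _ => sum_congr rfl fun b _ => sum_congr rfl fun x _ =>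
    sum_congr rfl fun y _ => sum_congr rfl fun i _ => ?_
  ring

/-- A local correlation wins with probability at most the classical value. -/
theorem IsLocal.winProb_le_classicalValue {p : A → B → X → Y → ℝ} (hp : IsLocal p)
    (pi : X → Y → ℝ) (W : A → B → X → Y → Bool) :
    winProb p pi W ≤ classicalValue pi W := by
  obtain ⟨μ, hμ, hsum, h⟩ := hp
  rw [winProb_sum h]
  calc ∑ fg, μ fg * winProb (detLocal fg.1 fg.2) pi W
      ≤ ∑ fg, μ fg * classicalValue pi W :=
        sum_le_sum fun fg _ => mul_le_mul_of_nonneg_left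
          (le_ciSup (f := fun fg : (X → A) × (Y → B) => winProb (detLocal fg.1 fg.2) pi W)
            (Set.finite_range _).bddAbove fg) (hμ fg)
    _ = classicalValue pi W := by rw [← sum_mul, hsum, one_mul]

/-- **Pseudotelepathy implies full nonlocality.** If `p` is a no-signaling perfect strategy
for a game whose classical value is `< 1`, then every decomposition of `p` into a local
part and a no-signaling part has local weight `0`, and hence `q_L^max(p) = 0`. -/
theorem pt_implies_fn [Nonempty A] [Nonempty B] [Nonempty X] [Nonempty Y]
    (pi : X → Y → ℝ) (W : A → B → X → Y → Bool)
    (hpi : (∀ x y, 0 ≤ pi x y) ∧ (∑ x, ∑ y, pi x y = 1))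
    (hC : classicalValue pi W < 1)
    (p : A → B → X → Y → ℝ) (hp : IsNSCorrelation p) (hwin : winProb p pi W = 1) :
    (∀ q : ℝ, 0 ≤ q → q ≤ 1 →
      ∀ pL pNL : A → B → X → Y → ℝ, IsLocal pL → IsNSCorrelation pNL →
      (∀ a b x y, p a b x y = q * pL a b x y + (1 - q) * pNL a b x y) → q = 0) ∧
    localContent p = 0 := by
  have key : ∀ q : ℝ, 0 ≤ q → q ≤ 1 →
      ∀ pL pNL : A → B → X → Y → ℝ, IsLocal pL → IsNSCorrelation pNL →
      (∀ a b x y, p a b x y = q * pL a b x y + (1 - q) * pNL a b x y) → q = 0 := by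
    intro q hq0 hq1 pL pNL hL hNL h
    have hmix := winProb_mixture h pi W
    have hL_le := mul_le_mul_of_nonneg_left (hL.winProb_le_classicalValue pi W) hq0
    have hNL_le := mul_le_mul_of_nonneg_left
      (winProb_le_one hNL.1 hpi.1 hpi.2 W) (sub_nonneg.2 hq1)
    by_contra hq
    have hpos : 0 < q := lt_of_le_of_ne hq0 (Ne.symm hq)
    have hlt := mul_lt_mul_of_pos_left hC hpos
    linarith
  refine ⟨key, le_antisymm (Real.sSup_nonpos ?_) (Real.sSup_nonneg fun q hq => hq.1)⟩
  rintro q ⟨hq0, hq1, pL, pNL, hL, hNL, h⟩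
  exact (key q hq0 hq1 pL pNL hL hNL h).le
end

section
/- (Strictly positive no-signaling correlations have positive local content.) Let p be a no-signaling correlation with p(a,b|x,y) > 0 for all a,b,x,y, and let m = min_{a,b,x,y} p(a,b|x,y). Then the uniform correlation u given by u(a,b|x,y) = 1/(|A|·|B|) is local, the function p' = (p − m·|A|·|B|·u)/(1 − m·|A|·|B|) is a no-signaling correlation when m·|A|·|B| < 1, and consequently q_L^max(p) ≥ m·|A|·|B| > 0. In particular, every no-signaling correlation with local content 0 has at least one zero entry. -/
open Finset

variable {A B X Y : Type*} [Fintype A] [Fintype B] [Fintype X] [Fintype Y]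
  [DecidableEq A] [DecidableEq B] [DecidableEq X] [DecidableEq Y]

/-- The no-signaling correlation in which both outcomes are independent and uniform. -/
noncomputable def uniformCorrelation (A B X Y : Type*) [Fintype A] [Fintype B] :
    A → B → X → Y → ℝ :=
  fun _ _ _ _ => 1 / ((Fintype.card A : ℝ) * (Fintype.card B : ℝ))

lemma card_mul_sum_ite_eq_apply (a : A) (x : X) :
    (Fintype.card A : ℝ) * ∑ f : X → A, (if a = f x then (1 : ℝ) else 0) =
      Fintype.card (X → A) := by
  have hswap (a' : A) : ∑ f : X → A, (if a' = f x then (1 : ℝ) else 0) =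
      ∑ f : X → A, (if a = f x then (1 : ℝ) else 0) := by
    refine Fintype.sum_equiv (Equiv.arrowCongr (Equiv.refl X) (Equiv.swap a a')) _ _ fun f => ?_
    have : a' = f x ↔ a = Equiv.swap a a' (f x) := by
      rw [eq_comm (a := a), Equiv.swap_apply_eq_iff, Equiv.swap_apply_left, eq_comm]
    simp [this]
  calc _ = ∑ a' : A, ∑ f : X → A, (if a' = f x then (1 : ℝ) else 0) := by simp [hswap]
    _ = _ := by rw [Finset.sum_comm]; simp

lemma isLocal_uniformCorrelation [Nonempty A] [Nonempty B] :
    IsLocal (uniformCorrelation A B X Y) := by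
  have hA : (Fintype.card A : ℝ) ≠ 0 := by simp
  have hB : (Fintype.card B : ℝ) ≠ 0 := by simp
  have hXA : (Fintype.card (X → A) : ℝ) ≠ 0 := Nat.cast_ne_zero.2 Fintype.card_ne_zero
  have hYB : (Fintype.card (Y → B) : ℝ) ≠ 0 := Nat.cast_ne_zero.2 Fintype.card_ne_zero
  refine ⟨fun _ => 1 / ((Fintype.card (X → A) : ℝ) * Fintype.card (Y → B)),
    fun _ => by positivity, ?_, fun a b x y => ?_⟩
  · rw [Finset.sum_const, Finset.card_univ, Fintype.card_prod, nsmul_eq_mul, Nat.cast_mul]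
    exact mul_one_div_cancel (mul_ne_zero hXA hYB)
  · have ha := card_mul_sum_ite_eq_apply a x
    have hb := card_mul_sum_ite_eq_apply b y
    rw [← Finset.mul_sum, Fintype.sum_prod_type]
    simp only [detLocal, uniformCorrelation]
    rw [← Fintype.sum_mul_sum (fun f : X → A => if a = f x then (1 : ℝ) else 0)
      (fun g : Y → B => if b = g y then (1 : ℝ) else 0), ← ha, ← hb]
    rw [← ha] at hXA
    rw [← hb] at hYB
    have h1 := right_ne_zero_of_mul hXA
    have h2 := right_ne_zero_of_mul hYB
    field_simp

section

variable {p : A → B → X → Y → ℝ} {m : ℝ}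

omit [Fintype X] [Fintype Y] [DecidableEq A] [DecidableEq B] [DecidableEq X] [DecidableEq Y] in
lemma IsCorrelation.mul_card_le_one [Nonempty X] [Nonempty Y] (hp : IsCorrelation p)
    (hm : ∀ a b x y, m ≤ p a b x y) :
    m * (Fintype.card A : ℝ) * (Fintype.card B : ℝ) ≤ 1 := by
  obtain ⟨x⟩ := ‹Nonempty X›
  obtain ⟨y⟩ := ‹Nonempty Y›
  calc m * (Fintype.card A : ℝ) * (Fintype.card B : ℝ)
      = ∑ _a : A, ∑ _b : B, m := by simp; ring
    _ ≤ ∑ a, ∑ b, p a b x y :=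
        Finset.sum_le_sum fun a _ => Finset.sum_le_sum fun b _ => hm a b x y
    _ = 1 := hp.2 x y

omit [Fintype X] [Fintype Y] [DecidableEq A] [DecidableEq B] [DecidableEq X] [DecidableEq Y] in
lemma IsCorrelation.eq_uniformCorrelation (hp : IsCorrelation p)
    (hm : ∀ a b x y, m ≤ p a b x y)
    (h1 : m * (Fintype.card A : ℝ) * (Fintype.card B : ℝ) = 1) :
    p = uniformCorrelation A B X Y := by
  have hAB : (Fintype.card A : ℝ) * (Fintype.card B : ℝ) ≠ 0 := by
    rw [mul_assoc] at h1
    exact right_ne_zero_of_mul (h1 ▸ one_ne_zero)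
  funext a b x y
  have hsum : ∑ ab : A × B, m = ∑ ab : A × B, p ab.1 ab.2 x y := by
    rw [Fintype.sum_prod_type (fun ab : A × B => p ab.1 ab.2 x y), hp.2 x y, ← h1]
    simp
    ring
  have := (Finset.sum_eq_sum_iff_of_le fun ab _ => hm ab.1 ab.2 x y).1 hsum (a, b)
    (Finset.mem_univ _)
  rw [uniformCorrelation, ← this, eq_div_iff hAB, ← mul_assoc, h1]

omit [Fintype X] [Fintype Y] [DecidableEq A] [DecidableEq B] [DecidableEq X] [DecidableEq Y] in
lemma IsNSCorrelation.sub_uniform_div [Nonempty A] [Nonempty B] (hp : IsNSCorrelation p)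
    (hm : ∀ a b x y, m ≤ p a b x y)
    (h1 : m * (Fintype.card A : ℝ) * (Fintype.card B : ℝ) < 1) :
    IsNSCorrelation (fun a b x y =>
      (p a b x y - m * (Fintype.card A : ℝ) * (Fintype.card B : ℝ) *
          uniformCorrelation A B X Y a b x y) /
        (1 - m * (Fintype.card A : ℝ) * (Fintype.card B : ℝ))) := by
  have hA : (Fintype.card A : ℝ) ≠ 0 := by simp
  have hB : (Fintype.card B : ℝ) ≠ 0 := by simp
  have hd := sub_pos.2 h1
  have hu (a : A) (b : B) (x : X) (y : Y) : m * (Fintype.card A : ℝ) * (Fintype.card B : ℝ) *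
      uniformCorrelation A B X Y a b x y = m := by
    unfold uniformCorrelation
    field_simp
  simp only [hu]
  obtain ⟨⟨-, hsum⟩, hAl, hBo⟩ := hp
  refine ⟨⟨fun a b x y => div_nonneg (sub_nonneg.2 (hm a b x y)) hd.le, fun x y => ?_⟩,
    fun a x y y' => ?_, fun b y x x' => ?_⟩
  · simp only [← Finset.sum_div, Finset.sum_sub_distrib, hsum]
    rw [div_eq_one_iff_eq hd.ne']
    simp
    ring
  · simp only [← Finset.sum_div, Finset.sum_sub_distrib, hAl a x y y']
  · simp only [← Finset.sum_div, Finset.sum_sub_distrib, hBo b y x x']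

lemma le_localContent {q : ℝ} {pL pNL : A → B → X → Y → ℝ} (h0 : 0 ≤ q) (h1 : q ≤ 1)
    (hL : IsLocal pL) (hNL : IsNSCorrelation pNL)
    (h : ∀ a b x y, p a b x y = q * pL a b x y + (1 - q) * pNL a b x y) :
    q ≤ localContent p :=
  le_csSup ⟨1, fun _ hr => hr.2.1⟩ ⟨h0, h1, pL, pNL, hL, hNL, h⟩

lemma IsNSCorrelation.mul_card_le_localContent [Nonempty A] [Nonempty B] [Nonempty X]
    [Nonempty Y] (hp : IsNSCorrelation p) (hm0 : 0 ≤ m) (hm : ∀ a b x y, m ≤ p a b x y) :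
    m * (Fintype.card A : ℝ) * (Fintype.card B : ℝ) ≤ localContent p := by
  have hle := hp.1.mul_card_le_one hm
  have h0 : 0 ≤ m * (Fintype.card A : ℝ) * (Fintype.card B : ℝ) := by positivity
  rcases hle.lt_or_eq with hlt | heq
  · refine le_localContent h0 hle isLocal_uniformCorrelation (hp.sub_uniform_div hm hlt)
      fun a b x y => ?_
    rw [mul_div_cancel₀ _ (sub_pos.2 hlt).ne', add_sub_cancel]
  · refine le_localContent h0 hle isLocal_uniformCorrelation hp fun a b x y => ?_
    rw [heq, ← hp.1.eq_uniformCorrelation hm heq]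
    ring

lemma IsNSCorrelation.localContent_pos [Nonempty A] [Nonempty B] [Nonempty X] [Nonempty Y]
    (hp : IsNSCorrelation p) (hpos : ∀ a b x y, 0 < p a b x y) : 0 < localContent p := by
  obtain ⟨⟨a, b, x, y⟩, hmin⟩ :=
    Finite.exists_min fun t : A × B × X × Y => p t.1 t.2.1 t.2.2.1 t.2.2.2
  have h := hpos a b x y
  exact lt_of_lt_of_le (by positivity)
    (hp.mul_card_le_localContent h.le fun a' b' x' y' => hmin (a', b', x', y'))

end

/-- **Strictly positive no-signaling correlations have positive local content.** If
`p(a,b|x,y) > 0` everywhere and `m` is the minimum entry of `p`, then the uniform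
correlation is local, `p' = (p − m·|A|·|B|·u)/(1 − m·|A|·|B|)` is a no-signaling
correlation when `m·|A|·|B| < 1`, and `q_L^max(p) ≥ m·|A|·|B| > 0`. In particular, a
no-signaling correlation with local content `0` has a zero entry. -/
theorem positive_correlation_has_positive_local_content
    [Nonempty A] [Nonempty B] [Nonempty X] [Nonempty Y]
    (p : A → B → X → Y → ℝ) (hp : IsNSCorrelation p)
    (hpos : ∀ a b x y, 0 < p a b x y) (m : ℝ)
    (hm_le : ∀ a b x y, m ≤ p a b x y)
    (hm_att : ∃ a b x y, p a b x y = m) :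
    IsLocal (fun (_ : A) (_ : B) (_ : X) (_ : Y) =>
        1 / ((Fintype.card A : ℝ) * (Fintype.card B : ℝ))) ∧
    (m * (Fintype.card A : ℝ) * (Fintype.card B : ℝ) < 1 →
      IsNSCorrelation (fun a b x y =>
        (p a b x y - m * (Fintype.card A : ℝ) * (Fintype.card B : ℝ) *
            (1 / ((Fintype.card A : ℝ) * (Fintype.card B : ℝ)))) /
          (1 - m * (Fintype.card A : ℝ) * (Fintype.card B : ℝ)))) ∧
    (m * (Fintype.card A : ℝ) * (Fintype.card B : ℝ) ≤ localContent p ∧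
      0 < m * (Fintype.card A : ℝ) * (Fintype.card B : ℝ)) ∧
    (∀ p' : A → B → X → Y → ℝ, IsNSCorrelation p' → localContent p' = 0 →
      ∃ a b x y, p' a b x y = 0) := by
  obtain ⟨a₀, b₀, x₀, y₀, h₀⟩ := hm_att
  have hm0 : 0 < m := h₀ ▸ hpos a₀ b₀ x₀ y₀
  refine ⟨isLocal_uniformCorrelation, hp.sub_uniform_div hm_le,
    ⟨hp.mul_card_le_localContent hm0.le hm_le, by positivity⟩, fun p' hp' h0 => ?_⟩
  by_contra! hne
  exact (hp'.localContent_pos fun a b x y =>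
    (hp'.1.1 a b x y).lt_of_ne' (hne a b x y)).ne' h0
end
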